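/- Let $X_1, X_2$ be $2$-dimensional real normed spaces with $\max\{d_{BM}(X_1, \ell_1^2), d_{BM}(X_2, \ell_1^2)\} \ge d_{BM}(X_1, X_2)$. Then for every integer $m \ge 1$, $d_{BM}(X_1 \oplus_1 \ell_1^m, X_2 \oplus_1 \ell_1^m) = d_{BM}(X_1, X_2)$. -/

import Mathlib

open scoped ENNReal

/-- The (multiplicative) Banach–Mazur distance between two normed spaces:
the infimum of `‖T‖ * ‖T⁻¹‖` over invertible (continuous) linear maps `T : E → F`. -/
noncomputable def dBM (E F : Type*) [NormedAddCommGroup E] [NormedSpace ℝ E]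
    [NormedAddCommGroup F] [NormedSpace ℝ F] : ℝ :=
  sInf {c : ℝ | ∃ T : E ≃L[ℝ] F, c = ‖(T : E →L[ℝ] F)‖ * ‖(T.symm : F →L[ℝ] E)‖}

/-- The `ℓ₁`-sum norm on `X × ℝⁿ`. -/
noncomputable def nn {X : Type} [NormedAddCommGroup X] {n : ℕ} (z : X × (Fin n → ℝ)) : ℝ :=
  ‖z.1‖ + ∑ k, |z.2 k|

section nnfacts
variable {X : Type} [NormedAddCommGroup X] [NormedSpace ℝ X] {n : ℕ}

lemma nn_nonneg (z : X × (Fin n → ℝ)) : 0 ≤ nn z := by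
  unfold nn; positivity

lemma nn_add (z w : X × (Fin n → ℝ)) : nn (z + w) ≤ nn z + nn w := by
  unfold nn
  have h1 := norm_add_le z.1 w.1
  have h2 : ∑ k, |(z + w).2 k| ≤ ∑ k, |z.2 k| + ∑ k, |w.2 k| := by
    rw [← Finset.sum_add_distrib]
    exact Finset.sum_le_sum fun k _ => abs_add_le _ _
  simp only [Prod.fst_add] at *
  linarith

lemma nn_smul (a : ℝ) (z : X × (Fin n → ℝ)) : nn (a • z) = |a| * nn z := by
  unfold nn
  simp [norm_smul, abs_mul, mul_add, Finset.mul_sum]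

lemma nn_sub (z w : X × (Fin n → ℝ)) : nn (z - w) ≤ nn z + nn w := by
  have h := nn_add z ((-1 : ℝ) • w)
  rw [nn_smul] at h
  simpa [sub_eq_add_neg] using h

/-- Forget the coordinate `j`. -/
def tl (j : Fin (n + 1)) : (X × (Fin (n + 1) → ℝ)) →ₗ[ℝ] (X × (Fin n → ℝ)) where
  toFun w := (w.1, fun k => w.2 (j.succAbove k))
  map_add' _ _ := rfl
  map_smul' _ _ := rfl

/-- Insert the coordinate `0` at `j`. -/
def ins (j : Fin (n + 1)) : (X × (Fin n → ℝ)) →ₗ[ℝ] (X × (Fin (n + 1) → ℝ)) where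
  toFun w := (w.1, j.insertNth (0 : ℝ) w.2)
  map_add' a b := by
    ext1
    · rfl
    · funext k
      refine Fin.succAboveCases j ?_ (fun l => ?_) k <;> simp
  map_smul' c a := by
    ext1
    · rfl
    · funext k
      refine Fin.succAboveCases j ?_ (fun l => ?_) k <;> simp

lemma nn_tl (j : Fin (n + 1)) (w : X × (Fin (n + 1) → ℝ)) : nn w = nn (tl j w) + |w.2 j| := by
  unfold nn
  rw [Fin.sum_univ_succAbove _ j]
  simp [tl]; ring

lemma nn_ins (j : Fin (n + 1)) (w : X × (Fin n → ℝ)) : nn (ins j w) = nn w := by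
  unfold nn
  rw [Fin.sum_univ_succAbove _ j]
  simp [ins]

lemma tl_ins (j : Fin (n + 1)) (w : X × (Fin n → ℝ)) : tl j (ins j w) = w := by
  ext <;> simp [tl, ins]

lemma ins_zero (j : Fin (n + 1)) (w : X × (Fin n → ℝ)) : (ins j w).2 j = 0 := by
  simp [ins]

lemma ins_tl (j : Fin (n + 1)) (w : X × (Fin (n + 1) → ℝ)) :
    ins j (tl j w) = w - w.2 j • ((0 : X), Pi.single j (1 : ℝ)) := by
  ext k
  · simp [ins, tl]
  · refine Fin.succAboveCases j ?_ (fun l => ?_) k <;> simp [ins, tl]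

/-- Projection along `v`. -/
noncomputable def qq (v : X × (Fin (n + 1) → ℝ)) :
    (X × (Fin (n + 1) → ℝ)) →ₗ[ℝ] (X × (Fin n → ℝ)) where
  toFun w := tl 0 w - (w.2 0 / v.2 0) • tl 0 v
  map_add' a b := by
    simp only [map_add, Prod.snd_add, Pi.add_apply, add_div, add_smul]; abel
  map_smul' c a := by
    simp only [map_smul, Prod.smul_snd, Pi.smul_apply, smul_eq_mul, RingHom.id_apply, smul_sub,
      smul_smul, mul_div_assoc]

lemma qq_apply (v w : X × (Fin (n + 1) → ℝ)) :
    qq v w = tl 0 w - (w.2 0 / v.2 0) • tl 0 v := rfl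

end nnfacts

/-- Distortion at most `c`. -/
def DD (X : Type) [NormedAddCommGroup X] [NormedSpace ℝ X] (n : ℕ)
    (Y : Type) [NormedAddCommGroup Y] [NormedSpace ℝ Y] (k : ℕ) (c : ℝ) : Prop :=
  ∃ S : (Y × (Fin k → ℝ)) ≃ₗ[ℝ] (X × (Fin n → ℝ)), ∀ z, nn z ≤ nn (S z) ∧ nn (S z) ≤ c * nn z

section steps
variable {X Y Y' : Type} [NormedAddCommGroup X] [NormedSpace ℝ X]
  [NormedAddCommGroup Y] [NormedSpace ℝ Y] [NormedAddCommGroup Y'] [NormedSpace ℝ Y']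

lemma compress {n k k' : ℕ} {c : ℝ} (hc : 0 ≤ c)
    (S : (Y × (Fin k → ℝ)) ≃ₗ[ℝ] (X × (Fin (n + 1) → ℝ)))
    (hS : ∀ z, nn z ≤ nn (S z) ∧ nn (S z) ≤ c * nn z)
    (p : (Y × (Fin k → ℝ)) →ₗ[ℝ] (Y' × (Fin k' → ℝ)))
    (s : (Y' × (Fin k' → ℝ)) →ₗ[ℝ] (Y × (Fin k → ℝ)))
    (hps : ∀ z, p (s z) = z) (hp : ∀ z, nn (p z) ≤ nn z) (hs : ∀ z, nn (s z) ≤ nn z)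
    (y : Y × (Fin k → ℝ)) (hy : p y = 0) (hsp : ∀ z, ∃ a : ℝ, s (p z) = z - a • y)
    (hv0 : (S y).2 0 ≠ 0) (hv : nn (S y) ≤ 2 * |(S y).2 0|) : DD X n Y' k' c := by
  set v := S y with hvdef
  have hqv : qq v v = 0 := by rw [qq_apply, div_self hv0, one_smul, sub_self]
  have hqi : ∀ w, qq v (ins 0 w) = w := by
    intro w; rw [qq_apply, ins_zero, zero_div, zero_smul, sub_zero, tl_ins]
  have hiq : ∀ w, ins 0 (qq v w) = w - (w.2 0 / v.2 0) • v := by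
    intro w
    rw [qq_apply, map_sub, map_smul, ins_tl, ins_tl, smul_sub, smul_smul, div_mul_cancel₀ _ hv0]
    abel
  have hq : ∀ w, nn (qq v w) ≤ nn w := by
    intro w
    rw [qq_apply]
    refine (nn_sub _ _).trans ?_
    rw [nn_smul, nn_tl 0 w, abs_div]
    have h1 : nn (tl 0 v) ≤ |v.2 0| := by
      have := nn_tl 0 v
      linarith
    have h2 : 0 < |v.2 0| := abs_pos.mpr hv0
    have h3 : |w.2 0| / |v.2 0| * nn (tl 0 v) ≤ |w.2 0| / |v.2 0| * |v.2 0| := by gcongr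
    rw [div_mul_cancel₀ _ h2.ne'] at h3
    linarith
  have e1 : ∀ w, qq v (S (s (p (S.symm (ins 0 w))))) = w := by
    intro w
    obtain ⟨a, ha⟩ := hsp (S.symm (ins 0 w))
    rw [ha, map_sub, map_smul, ← hvdef, LinearEquiv.apply_symm_apply, map_sub, map_smul, hqv,
      hqi, smul_zero, sub_zero]
  have e2 : ∀ z, p (S.symm (ins 0 (qq v (S (s z))))) = z := by
    intro z
    rw [hiq, map_sub, map_smul, LinearEquiv.symm_apply_apply, hvdef, LinearEquiv.symm_apply_apply,
      map_sub, map_smul, hy, smul_zero, sub_zero, hps]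
  refine ⟨LinearEquiv.ofLinearMap (qq v ∘ₗ S.toLinearMap ∘ₗ s)
    (p ∘ₗ S.symm.toLinearMap ∘ₗ ins 0) (LinearMap.ext e1) (LinearMap.ext e2), fun z => ?_⟩
  change nn z ≤ nn (qq v (S (s z))) ∧ nn (qq v (S (s z))) ≤ c * nn z
  constructor
  · calc nn z = nn (p (S.symm (ins 0 (qq v (S (s z)))))) := by rw [e2]
      _ ≤ nn (S.symm (ins 0 (qq v (S (s z))))) := hp _
      _ ≤ nn (S (S.symm (ins 0 (qq v (S (s z)))))) := (hS _).1
      _ = _ := by rw [LinearEquiv.apply_symm_apply, nn_ins]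
  · calc nn (qq v (S (s z))) ≤ nn (S (s z)) := hq _
      _ ≤ c * nn (s z) := (hS _).2
      _ ≤ c * nn z := by gcongr; exact hs z

lemma attain {n k : ℕ} {c : ℝ}
    (S : (Y × (Fin k → ℝ)) ≃ₗ[ℝ] (X × (Fin (n + 1) → ℝ)))
    (hS : ∀ z, nn z ≤ nn (S z) ∧ nn (S z) ≤ c * nn z) :
    (∃ j, 1 ≤ |(S (0, Pi.single j 1)).2 0|) ∨ ∃ y : Y, y ≠ 0 ∧ ‖y‖ ≤ |(S (y, 0)).2 0| := by
  by_contra! hcon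
  obtain ⟨h1, h2⟩ := hcon
  set z := S.symm (0, Pi.single 0 1) with hz
  have hSz : S z = (0, Pi.single 0 1) := by rw [hz, LinearEquiv.apply_symm_apply]
  have hnz : nn z ≤ 1 := by
    have := (hS z).1
    rw [hSz] at this
    refine this.trans (le_of_eq ?_)
    unfold nn
    rw [Fin.sum_univ_succ]; simp
  have hdec : z = (z.1, 0) + ∑ j, z.2 j • ((0 : Y), (Pi.single j 1 : Fin k → ℝ)) := by
    ext i
    · simp [Prod.fst_sum]
    · simp [Prod.snd_sum, Finset.sum_apply, Pi.single_apply]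
  have hval : (1 : ℝ) = (S (z.1, 0)).2 0 + ∑ j, z.2 j * (S (0, Pi.single j 1)).2 0 := by
    have h3 : (S z).2 0 = 1 := by rw [hSz]; simp
    rw [hdec, map_add, map_sum] at h3
    simp only [map_smul, Prod.snd_add, Pi.add_apply, Prod.snd_sum, Finset.sum_apply,
      Prod.smul_snd, Pi.smul_apply, smul_eq_mul] at h3
    exact h3.symm
  have hb1 : |(S (z.1, 0)).2 0| ≤ ‖z.1‖ := by
    by_cases hy : z.1 = 0
    · rw [hy]
      have : ((0 : Y), (0 : Fin k → ℝ)) = 0 := rfl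
      rw [this, map_zero]; simp
    · exact (h2 _ hy).le
  have hb2 : ∀ j, z.2 j * (S (0, Pi.single j 1)).2 0 ≤ |z.2 j| := fun j => by
    refine (le_abs_self _).trans ?_
    rw [abs_mul]
    exact mul_le_of_le_one_right (abs_nonneg _) (h1 j).le
  have hsum := Finset.sum_le_sum (fun j (_ : j ∈ Finset.univ) => hb2 j)
  have hle := le_abs_self ((S (z.1, 0)).2 0)
  unfold nn at hnz
  by_cases hy : z.1 = 0
  · have hj : ∃ j, z.2 j ≠ 0 := by
      by_contra! hall
      have : z = 0 := by
        ext i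
        · exact hy
        · exact hall i
      rw [this, map_zero] at hSz
      have := congrArg (fun w => w.2 0) hSz
      simp at this
    obtain ⟨j, hj⟩ := hj
    have hlt : z.2 j * (S (0, Pi.single j 1)).2 0 < |z.2 j| := by
      refine (le_abs_self _).trans_lt ?_
      rw [abs_mul]
      exact mul_lt_of_lt_one_right (abs_pos.mpr hj) (h1 j)
    have := Finset.sum_lt_sum (fun j (_ : j ∈ Finset.univ) => hb2 j) ⟨j, Finset.mem_univ _, hlt⟩
    linarith
  · have := h2 _ hy
    linarith

lemma nn_y {k : ℕ} (y : Y) : nn (y, (0 : Fin k → ℝ)) = ‖y‖ := by simp [nn]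

lemma nn_e {k : ℕ} (j : Fin k) : nn ((0 : Y), (Pi.single j 1 : Fin k → ℝ)) = 1 := by
  simp only [nn, norm_zero, zero_add]
  rw [Finset.sum_eq_single j] <;> simp +contextual [Pi.single_apply]

lemma stepA {n k : ℕ} {c : ℝ} (hc : 0 ≤ c) (hc2 : c ≤ 2)
    (S : (Y × (Fin (k + 1) → ℝ)) ≃ₗ[ℝ] (X × (Fin (n + 1) → ℝ)))
    (hS : ∀ z, nn z ≤ nn (S z) ∧ nn (S z) ≤ c * nn z) (j : Fin (k + 1))
    (hj : 1 ≤ |(S (0, Pi.single j 1)).2 0|) : DD X n Y k c := by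
  refine compress hc S hS (tl j) (ins j) (tl_ins j) (fun z => ?_) (fun z => (nn_ins j z).le)
    (0, Pi.single j 1) ?_ (fun z => ⟨_, ins_tl j z⟩) ?_ ?_
  · have := nn_tl j z
    have := abs_nonneg (z.2 j)
    linarith
  · ext <;> simp [tl]
  · intro h0
    rw [h0] at hj; norm_num at hj
  · have := (hS (0, Pi.single j 1)).2
    rw [nn_e] at this
    linarith

end steps

section plane
variable {Y : Type} [NormedAddCommGroup Y] [NormedSpace ℝ Y]

/-- A determinant form on a plane. -/
lemma exists_det (h : Module.finrank ℝ Y = 2) : ∃ B : Y →ₗ[ℝ] Y →ₗ[ℝ] ℝ,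
    Continuous (fun z : Y × Y => B z.1 z.2) ∧ (∀ x a b, B x b • a + B a x • b = B a b • x) ∧
    (∀ y, y ≠ 0 → ∃ z, 0 < B y z) ∧ (∀ y, B y y = 0) := by
  have hf : FiniteDimensional ℝ Y := Module.finite_of_finrank_pos (by omega)
  let b := Module.finBasisOfFinrankEq ℝ Y h
  let B : Y →ₗ[ℝ] Y →ₗ[ℝ] ℝ := LinearMap.mk₂ ℝ
    (fun u v => b.coord 0 u * b.coord 1 v - b.coord 1 u * b.coord 0 v)
    (by intros; simp only [map_add]; ring) (by intros; simp only [map_smul, smul_eq_mul]; ring)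
    (by intros; simp only [map_add]; ring) (by intros; simp only [map_smul, smul_eq_mul]; ring)
  have hB : ∀ u v, B u v = b.coord 0 u * b.coord 1 v - b.coord 1 u * b.coord 0 v :=
    fun u v => rfl
  refine ⟨B, ?_, ?_, ?_, ?_⟩
  · have c0 : Continuous (b.coord 0) := LinearMap.continuous_of_finiteDimensional _
    have c1 : Continuous (b.coord 1) := LinearMap.continuous_of_finiteDimensional _
    simp only [hB]
    fun_prop
  · intro x a c
    apply b.ext_elem
    intro i
    have : ∀ u, b.repr u i = b.coord i u := fun u => rfl
    rw [this, this, map_add, map_smul, map_smul, map_smul]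
    simp only [smul_eq_mul, hB]
    fin_cases i <;> simp only [Fin.zero_eta, Fin.mk_one] <;> ring
  · intro y hy
    have hne : ∃ z, B y z ≠ 0 := by
      by_contra! hall
      apply hy
      have h0 := hall (b 0)
      have h1 := hall (b 1)
      simp [hB] at h0 h1
      apply b.ext_elem
      intro i
      fin_cases i
      · simpa using h1
      · simpa using h0
    obtain ⟨z, hz⟩ := hne
    rcases lt_or_gt_of_ne hz with h | h
    · exact ⟨-z, by simpa using h⟩
    · exact ⟨z, h⟩
  · intro y; rw [hB]; ring

lemma exists_norming (h : Module.finrank ℝ Y = 2) (y : Y) (hy : y ≠ 0) :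
    ∃ (f : Y →ₗ[ℝ] ℝ) (z : Y), (∀ x, |f x| ≤ ‖x‖) ∧ ‖z‖ ≤ 1 ∧ f z = 1 ∧ f y = 0 ∧
      ∀ x, ∃ a : ℝ, f x • z = x - a • y := by
  have hf : FiniteDimensional ℝ Y := Module.finite_of_finrank_pos (by omega)
  obtain ⟨B, hB, hid, hne, hself⟩ := exists_det h
  have hcont : Continuous (B y) := LinearMap.continuous_of_finiteDimensional _
  obtain ⟨z, hz, hmax⟩ := (isCompact_closedBall (0 : Y) 1).exists_isMaxOn
    ⟨0, by simp⟩ hcont.continuousOn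
  have key : ∀ x, B y x ≤ B y z * ‖x‖ := by
    intro x
    by_cases hx : x = 0
    · simp [hx]
    have hxn : 0 < ‖x‖ := norm_pos_iff.mpr hx
    have := hmax (show ‖x‖⁻¹ • x ∈ Metric.closedBall (0 : Y) 1 by
      simp [norm_smul, hxn.ne'])
    simp only [Set.mem_setOf_eq, map_smul, smul_eq_mul] at this
    rwa [inv_mul_le_iff₀ hxn, mul_comm] at this
  obtain ⟨w, hw⟩ := hne y hy
  have hM : 0 < B y z := by
    by_contra hle
    have := key w
    have h2 : B y z * ‖w‖ ≤ 0 := mul_nonpos_of_nonpos_of_nonneg (not_lt.mp hle) (norm_nonneg _)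
    linarith
  refine ⟨(B y z)⁻¹ • B y, z, fun x => ?_, by simpa using hz, ?_, ?_, fun x => ?_⟩
  · have h1 := key x
    have h2 := key (-x)
    rw [map_neg, norm_neg] at h2
    rw [LinearMap.smul_apply, smul_eq_mul, abs_mul, abs_of_pos (inv_pos.mpr hM),
      inv_mul_le_iff₀ hM]
    exact abs_le.mpr ⟨by linarith, h1⟩
  · simp [hM.ne']
  · simp [hself]
  · refine ⟨(B y z)⁻¹ * B x z, ?_⟩
    have := hid x y z
    have h3 : x = (B y z)⁻¹ • (B x z • y + B y x • z) := by
      rw [this, smul_smul, inv_mul_cancel₀ hM.ne', one_smul]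
    refine eq_sub_of_add_eq ?_
    conv_rhs => rw [h3]
    simp only [LinearMap.smul_apply, smul_eq_mul, smul_add, smul_smul]
    abel

lemma auerbach (h : Module.finrank ℝ Y = 2) : DD Y 0 PUnit 2 2 := by
  have hfin : FiniteDimensional ℝ Y := Module.finite_of_finrank_pos (by omega)
  have hnt : Nontrivial Y := Module.nontrivial_of_finrank_pos (R := ℝ) (by omega)
  obtain ⟨B, hB, hid, hne, hself⟩ := exists_det h
  obtain ⟨⟨a, b⟩, hab, hmax⟩ := ((isCompact_closedBall (0 : Y) 1).prod
    (isCompact_closedBall (0 : Y) 1)).exists_isMaxOn ⟨(0, 0), by simp⟩ hB.continuousOn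
  have ha : ‖a‖ ≤ 1 := by simpa using hab.1
  have hb : ‖b‖ ≤ 1 := by simpa using hab.2
  have hmax' : ∀ u v : Y, ‖u‖ ≤ 1 → ‖v‖ ≤ 1 → B u v ≤ B a b := by
    intro u v hu hv
    exact hmax (show (u, v) ∈ Metric.closedBall (0 : Y) 1 ×ˢ Metric.closedBall (0 : Y) 1 from
      ⟨by simpa using hu, by simpa using hv⟩)
  have hunit : ∀ x : Y, ‖‖x‖⁻¹ • x‖ ≤ 1 := by
    intro x
    rw [norm_smul, norm_inv, norm_norm]
    exact inv_mul_le_one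
  have key1 : ∀ x, B x b ≤ B a b * ‖x‖ := by
    intro x
    by_cases hx : x = 0
    · simp [hx]
    have hxn : 0 < ‖x‖ := norm_pos_iff.mpr hx
    have := hmax' (‖x‖⁻¹ • x) b (hunit x) hb
    rw [map_smul, LinearMap.smul_apply, smul_eq_mul] at this
    rwa [inv_mul_le_iff₀ hxn, mul_comm] at this
  have key2 : ∀ x, B a x ≤ B a b * ‖x‖ := by
    intro x
    by_cases hx : x = 0
    · simp [hx]
    have hxn : 0 < ‖x‖ := norm_pos_iff.mpr hx
    have := hmax' a (‖x‖⁻¹ • x) ha (hunit x)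
    rw [map_smul, smul_eq_mul] at this
    rwa [inv_mul_le_iff₀ hxn, mul_comm] at this
  have hM : 0 < B a b := by
    obtain ⟨y, hy⟩ := exists_ne (0 : Y)
    obtain ⟨w, hw⟩ := hne y hy
    have hw0 : w ≠ 0 := by
      rintro rfl
      simp at hw
    have := hmax' (‖y‖⁻¹ • y) (‖w‖⁻¹ • w) (hunit y) (hunit w)
    rw [map_smul, map_smul, LinearMap.smul_apply, smul_eq_mul, smul_eq_mul] at this
    have h1 : 0 < ‖y‖ := norm_pos_iff.mpr hy
    have h2 : 0 < ‖w‖ := norm_pos_iff.mpr hw0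
    exact lt_of_lt_of_le (by positivity) this
  have hba : ∀ x, B x a * 1 = - B a x := by
    intro x
    have := hself (x + a)
    simp only [map_add, LinearMap.add_apply, hself] at this
    linarith
  have abs1 : ∀ x, |(B a b)⁻¹ * B x b| ≤ ‖x‖ := by
    intro x
    have h1 := key1 x
    have h2 := key1 (-x)
    rw [map_neg, norm_neg, LinearMap.neg_apply] at h2
    rw [abs_mul, abs_of_pos (inv_pos.mpr hM), inv_mul_le_iff₀ hM]
    exact abs_le.mpr ⟨by linarith, h1⟩
  have abs2 : ∀ x, |(B a b)⁻¹ * B a x| ≤ ‖x‖ := by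
    intro x
    have h1 := key2 x
    have h2 := key2 (-x)
    rw [map_neg, norm_neg] at h2
    rw [abs_mul, abs_of_pos (inv_pos.mpr hM), inv_mul_le_iff₀ hM]
    exact abs_le.mpr ⟨by linarith, h1⟩
  -- the maps
  let S : (PUnit × (Fin 2 → ℝ)) →ₗ[ℝ] (Y × (Fin 0 → ℝ)) :=
    { toFun := fun w => ((2 * w.2 0) • a + (2 * w.2 1) • b, 0)
      map_add' := fun u v => by
        ext1
        · simp only [Prod.snd_add, Pi.add_apply, Prod.fst_add]; module
        · simp
      map_smul' := fun u v => by
        ext1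
        · simp only [Prod.smul_snd, Pi.smul_apply, smul_eq_mul, RingHom.id_apply, Prod.smul_fst]
          module
        · simp }
  let R : (Y × (Fin 0 → ℝ)) →ₗ[ℝ] (PUnit × (Fin 2 → ℝ)) :=
    { toFun := fun w => (0, ![2⁻¹ * ((B a b)⁻¹ * B w.1 b), 2⁻¹ * ((B a b)⁻¹ * B a w.1)])
      map_add' := fun u v => by
        ext i
        fin_cases i <;> simp [mul_add]
      map_smul' := fun u v => by
        ext i
        fin_cases i <;> simp <;> ring }
  have hS : ∀ w, S w = ((2 * w.2 0) • a + (2 * w.2 1) • b, 0) := fun w => rfl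
  have hR : ∀ w, R w = (0, ![2⁻¹ * ((B a b)⁻¹ * B w.1 b), 2⁻¹ * ((B a b)⁻¹ * B a w.1)]) :=
    fun w => rfl
  have e1 : ∀ w, S (R w) = w := by
    intro w
    rw [hS, hR]
    ext1
    · have h3 : w.1 = (B a b)⁻¹ • (B w.1 b • a + B a w.1 • b) := by
        rw [hid, smul_smul, inv_mul_cancel₀ hM.ne', one_smul]
      conv_rhs => rw [h3]
      simp only [Matrix.cons_val_zero, Matrix.cons_val_one, smul_add, smul_smul]
      congr 2 <;> ring
    · exact Subsingleton.elim _ _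
  have e2 : ∀ w, R (S w) = w := by
    intro w
    rw [hS, hR]
    ext i
    fin_cases i
    · simp [hself]
      field_simp
    · simp [hself]
      field_simp
  refine ⟨LinearEquiv.ofLinearMap S R (LinearMap.ext e1) (LinearMap.ext e2), fun z => ?_⟩
  change nn z ≤ nn (S z) ∧ nn (S z) ≤ 2 * nn z
  have hz : nn z = |z.2 0| + |z.2 1| := by simp [nn]
  constructor
  · have hnz : nn z = nn (R (S z)) := by rw [e2]
    rw [hnz, hR]
    have h1 := abs1 (S z).1
    have h2 := abs2 (S z).1
    simp only [nn, Fin.sum_univ_two, Matrix.cons_val_zero, Matrix.cons_val_one, norm_zero,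
      abs_mul (2⁻¹ : ℝ), Finset.univ_eq_empty, Finset.sum_empty]
    rw [abs_of_pos (by norm_num : (0 : ℝ) < 2⁻¹)]
    linarith
  · rw [hz, hS]
    simp only [nn, Finset.univ_eq_empty, Finset.sum_empty, add_zero]
    refine (norm_add_le _ _).trans ?_
    rw [norm_smul, norm_smul, Real.norm_eq_abs, Real.norm_eq_abs, abs_mul, abs_mul, abs_two]
    have h1 := mul_le_mul_of_nonneg_left ha (abs_nonneg (z.2 0))
    have h2 := mul_le_mul_of_nonneg_left hb (abs_nonneg (z.2 1))
    linarith

lemma stepB {X : Type} [NormedAddCommGroup X] [NormedSpace ℝ X] (h : Module.finrank ℝ Y = 2)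
    {n k : ℕ} {c : ℝ} (hc : 0 ≤ c) (hc2 : c ≤ 2)
    (S : (Y × (Fin k → ℝ)) ≃ₗ[ℝ] (X × (Fin (n + 1) → ℝ)))
    (hS : ∀ z, nn z ≤ nn (S z) ∧ nn (S z) ≤ c * nn z) (y : Y) (hy : y ≠ 0)
    (hj : ‖y‖ ≤ |(S (y, 0)).2 0|) : DD X n PUnit (k + 1) c := by
  obtain ⟨f, z, hf, hz, hfz, hfy, hfx⟩ := exists_norming h y hy
  have hyn : 0 < ‖y‖ := norm_pos_iff.mpr hy
  let p : (Y × (Fin k → ℝ)) →ₗ[ℝ] (PUnit × (Fin (k + 1) → ℝ)) :=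
    { toFun := fun w => (0, Fin.cons (f w.1) w.2)
      map_add' := fun a b => by
        ext i
        refine Fin.cases ?_ (fun l => ?_) i <;> simp
      map_smul' := fun a b => by
        ext i
        refine Fin.cases ?_ (fun l => ?_) i <;> simp }
  let s : (PUnit × (Fin (k + 1) → ℝ)) →ₗ[ℝ] (Y × (Fin k → ℝ)) :=
    { toFun := fun w => (w.2 0 • z, fun l => w.2 l.succ)
      map_add' := fun a b => by
        ext i <;> simp [add_smul]
      map_smul' := fun a b => by
        ext i <;> simp [mul_smul] }
  have hp : ∀ w, p w = (0, Fin.cons (f w.1) w.2) := fun w => rfl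
  have hs : ∀ w, s w = (w.2 0 • z, fun l => w.2 l.succ) := fun w => rfl
  refine compress hc S hS p s ?_ ?_ ?_ (y, 0) ?_ ?_ ?_ ?_
  · intro w
    rw [hs, hp]
    ext i
    refine Fin.cases ?_ (fun l => ?_) i <;> simp [hfz]
  · intro w
    rw [hp]; unfold nn
    rw [Fin.sum_univ_succ]
    have := hf w.1
    simp [this]
  · intro w
    rw [hs]; unfold nn
    rw [Fin.sum_univ_succ]
    have : ‖w.2 0 • z‖ ≤ |w.2 0| := by
      rw [norm_smul, Real.norm_eq_abs]
      exact mul_le_of_le_one_right (abs_nonneg _) hz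
    have h2 := norm_nonneg w.1
    simp only
    linarith
  · rw [hp]
    ext i
    refine Fin.cases ?_ (fun l => ?_) i <;> simp [hfy]
  · intro w
    obtain ⟨a, ha⟩ := hfx w.1
    refine ⟨a, ?_⟩
    rw [hp, hs]
    ext i <;> simp [ha]
  · intro h0
    rw [h0, abs_zero] at hj
    linarith
  · have := (hS (y, 0)).2
    rw [nn_y] at this
    nlinarith

end plane

section main
variable {X Y : Type} [NormedAddCommGroup X] [NormedSpace ℝ X]
  [NormedAddCommGroup Y] [NormedSpace ℝ Y]

lemma claim2 {c : ℝ} (hc : 0 ≤ c) (hc2 : c ≤ 2) : ∀ n : ℕ, DD X n PUnit (n + 2) c →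
    DD X 0 PUnit 2 c
  | 0, h => h
  | n + 1, ⟨S, hS⟩ => by
    rcases attain S hS with ⟨j, hj⟩ | ⟨y, hy, _⟩
    · exact claim2 hc hc2 n (stepA hc hc2 S hS j hj)
    · exact absurd (Subsingleton.elim _ _) hy

lemma claim1 (h : Module.finrank ℝ Y = 2) {c : ℝ} (hc : 0 ≤ c) (hc2 : c ≤ 2) :
    ∀ n : ℕ, DD X n Y n c → DD X 0 Y 0 c ∨ DD X 0 PUnit 2 c
  | 0, h => Or.inl h
  | n + 1, ⟨S, hS⟩ => by
    rcases attain S hS with ⟨j, hj⟩ | ⟨y, hy, hj⟩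
    · exact claim1 h hc hc2 n (stepA hc hc2 S hS j hj)
    · exact Or.inr (claim2 hc hc2 n (stepB h hc hc2 S hS y hy hj))

end main

section bm
variable {E F : Type} [NormedAddCommGroup E] [NormedSpace ℝ E]
  [NormedAddCommGroup F] [NormedSpace ℝ F]

lemma dBM_le_equiv (T : E ≃L[ℝ] F) :
    dBM E F ≤ ‖(T : E →L[ℝ] F)‖ * ‖(T.symm : F →L[ℝ] E)‖ := by
  refine csInf_le ⟨0, ?_⟩ ⟨T, rfl⟩
  rintro c ⟨T, rfl⟩
  positivity

lemma dBM_le_of {c : ℝ} (hc : 0 ≤ c) (S : F ≃ₗ[ℝ] E)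
    (hS : ∀ z, ‖z‖ ≤ ‖S z‖ ∧ ‖S z‖ ≤ c * ‖z‖) : dBM E F ≤ c := by
  let T : F ≃L[ℝ] E := S.toContinuousLinearEquivOfBounds c 1 (fun z => (hS z).2) (fun z => by
    have := (hS (S.symm z)).1
    simpa using this)
  refine (dBM_le_equiv T.symm).trans ?_
  have h1 : ‖(T.symm : E →L[ℝ] F)‖ ≤ 1 :=
    ContinuousLinearMap.opNorm_le_bound _ zero_le_one (fun z => by
      have := (hS (S.symm z)).1
      rw [LinearEquiv.apply_symm_apply] at this
      rw [one_mul]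
      exact this)
  have h2 : ‖(T.symm.symm : F →L[ℝ] E)‖ ≤ c :=
    ContinuousLinearMap.opNorm_le_bound _ hc (fun z => (hS z).2)
  calc _ ≤ 1 * c := by gcongr
    _ = c := one_mul c

lemma dBM_comm' : dBM E F = dBM F E := by
  unfold dBM
  congr 1
  ext c
  constructor
  · rintro ⟨T, rfl⟩
    exact ⟨T.symm, by rw [mul_comm]; rfl⟩
  · rintro ⟨T, rfl⟩
    exact ⟨T.symm, by rw [mul_comm]; rfl⟩

lemma exists_S [Nontrivial E] (T : E ≃L[ℝ] F) : ∃ S : F ≃ₗ[ℝ] E, ∀ z, ‖z‖ ≤ ‖S z‖ ∧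
    ‖S z‖ ≤ (‖(T : E →L[ℝ] F)‖ * ‖(T.symm : F →L[ℝ] E)‖) * ‖z‖ := by
  have hpos : 0 < ‖(T : E →L[ℝ] F)‖ := T.norm_pos
  refine ⟨T.symm.toLinearEquiv.trans
    (LinearEquiv.smulOfNeZero ℝ E ‖(T : E →L[ℝ] F)‖ hpos.ne'), fun z => ?_⟩
  change ‖z‖ ≤ ‖‖(T : E →L[ℝ] F)‖ • T.symm z‖ ∧ ‖‖(T : E →L[ℝ] F)‖ • T.symm z‖ ≤ _
  rw [norm_smul, norm_norm]
  constructor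
  · have := (T : E →L[ℝ] F).le_opNorm (T.symm z)
    simpa using this
  · rw [mul_assoc]
    gcongr
    exact (T.symm : F →L[ℝ] E).le_opNorm z

/-- Identify the `WithLp` sum with the plain product. -/
noncomputable def ee (X : Type) [NormedAddCommGroup X] [NormedSpace ℝ X] (m : ℕ) :
    WithLp 1 (X × PiLp 1 fun _ : Fin m => ℝ) ≃ₗ[ℝ] X × (Fin m → ℝ) :=
  (WithLp.linearEquiv 1 ℝ (X × PiLp 1 fun _ : Fin m => ℝ)).trans
    ((LinearEquiv.refl ℝ X).prodCongr (WithLp.linearEquiv 1 ℝ (Fin m → ℝ)))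

lemma nn_ee (m : ℕ) (z : WithLp 1 (E × PiLp 1 fun _ : Fin m => ℝ)) : nn (ee E m z) = ‖z‖ := by
  rw [WithLp.prod_norm_eq_of_L1, PiLp.norm_eq_of_L1]
  rfl

lemma nn_ee_symm (m : ℕ) (z : E × (Fin m → ℝ)) : ‖(ee E m).symm z‖ = nn z := by
  rw [← nn_ee, LinearEquiv.apply_symm_apply]

lemma dBM_le_l1 {c : ℝ} (hc : 0 ≤ c) (h : DD E 0 PUnit 2 c) :
    dBM E (PiLp 1 fun _ : Fin 2 => ℝ) ≤ c := by
  obtain ⟨S, hS⟩ := h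
  let a : (PiLp 1 fun _ : Fin 2 => ℝ) ≃ₗ[ℝ] (PUnit × (Fin 2 → ℝ)) :=
    (WithLp.linearEquiv 1 ℝ (Fin 2 → ℝ)).trans (LinearEquiv.uniqueProd).symm
  let b : (E × (Fin 0 → ℝ)) ≃ₗ[ℝ] E := LinearEquiv.prodUnique
  have ha : ∀ z, nn (a z) = ‖z‖ := by
    intro z
    rw [PiLp.norm_eq_of_L1]
    simp [nn, a]
  have hb : ∀ z, ‖b z‖ = nn z := by
    intro z
    simp [nn, b]
  refine dBM_le_of hc ((a.trans S).trans b) (fun z => ?_)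
  have := hS (a z)
  simpa [ha, hb] using this

lemma dBM_le_zero {c : ℝ} (hc : 0 ≤ c) (h : DD E 0 F 0 c) : dBM E F ≤ c := by
  obtain ⟨S, hS⟩ := h
  let a : (F × (Fin 0 → ℝ)) ≃ₗ[ℝ] F := LinearEquiv.prodUnique
  let b : (E × (Fin 0 → ℝ)) ≃ₗ[ℝ] E := LinearEquiv.prodUnique
  have ha : ∀ z, nn (a.symm z) = ‖z‖ := by
    intro z
    simp [nn, a]
  have hb : ∀ z, ‖b z‖ = nn z := by
    intro z
    simp [nn, b]
  refine dBM_le_of hc ((a.symm.trans S).trans b) (fun z => ?_)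
  have := hS (a.symm z)
  simpa [ha, hb] using this

lemma DD_of (m : ℕ) [Nontrivial E] (T : WithLp 1 (E × PiLp 1 fun _ : Fin m => ℝ) ≃L[ℝ]
      WithLp 1 (F × PiLp 1 fun _ : Fin m => ℝ)) :
    DD E m F m (‖(T : WithLp 1 (E × PiLp 1 fun _ : Fin m => ℝ) →L[ℝ] WithLp 1 (F × PiLp 1 fun _ : Fin m => ℝ))‖ *
      ‖(T.symm : WithLp 1 (F × PiLp 1 fun _ : Fin m => ℝ) →L[ℝ] WithLp 1 (E × PiLp 1 fun _ : Fin m => ℝ))‖) := by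
  have : Nontrivial (WithLp 1 (E × PiLp 1 fun _ : Fin m => ℝ)) :=
    (ee E m).toEquiv.nontrivial
  obtain ⟨S, hS⟩ := exists_S T
  refine ⟨((ee F m).symm.trans S).trans (ee E m), fun z => ?_⟩
  have := hS ((ee F m).symm z)
  rw [nn_ee_symm] at this
  simpa only [LinearEquiv.trans_apply, nn_ee] using this

lemma lower (hE : Module.finrank ℝ E = 2) (hF : Module.finrank ℝ F = 2)
    (h : dBM E F ≤ dBM E (PiLp 1 fun _ : Fin 2 => ℝ)) (m : ℕ)
    (T : WithLp 1 (E × PiLp 1 fun _ : Fin m => ℝ) ≃L[ℝ]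
      WithLp 1 (F × PiLp 1 fun _ : Fin m => ℝ)) :
    dBM E F ≤ ‖(T : WithLp 1 (E × PiLp 1 fun _ : Fin m => ℝ) →L[ℝ] WithLp 1 (F × PiLp 1 fun _ : Fin m => ℝ))‖ *
      ‖(T.symm : WithLp 1 (F × PiLp 1 fun _ : Fin m => ℝ) →L[ℝ] WithLp 1 (E × PiLp 1 fun _ : Fin m => ℝ))‖ := by
  have : Nontrivial E := Module.nontrivial_of_finrank_pos (R := ℝ) (by omega)
  have hD := DD_of m T
  set c := ‖(T : WithLp 1 (E × PiLp 1 fun _ : Fin m => ℝ) →L[ℝ] WithLp 1 (F × PiLp 1 fun _ : Fin m => ℝ))‖ *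
      ‖(T.symm : WithLp 1 (F × PiLp 1 fun _ : Fin m => ℝ) →L[ℝ] WithLp 1 (E × PiLp 1 fun _ : Fin m => ℝ))‖ with hcdef
  have hc : 0 ≤ c := by positivity
  by_cases hc2 : c ≤ 2
  · rcases claim1 hF hc hc2 m hD with h1 | h1
    · exact dBM_le_zero hc h1
    · exact h.trans (dBM_le_l1 hc h1)
  · exact (h.trans (dBM_le_l1 zero_le_two (auerbach hE))).trans (not_le.mp hc2).le

lemma upper (m : ℕ) [Nontrivial E] (T : E ≃L[ℝ] F) :
    dBM (WithLp 1 (E × PiLp 1 fun _ : Fin m => ℝ)) (WithLp 1 (F × PiLp 1 fun _ : Fin m => ℝ))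
      ≤ ‖(T : E →L[ℝ] F)‖ * ‖(T.symm : F →L[ℝ] E)‖ := by
  obtain ⟨S, hS⟩ := exists_S T
  set c := ‖(T : E →L[ℝ] F)‖ * ‖(T.symm : F →L[ℝ] E)‖ with hcdef
  have hc : 1 ≤ c := by
    have hnt : Nontrivial F := T.symm.toEquiv.nontrivial
    obtain ⟨x, hx⟩ := exists_ne (0 : F)
    have h1 := (hS x).1.trans (hS x).2
    have hxn : 0 < ‖x‖ := norm_pos_iff.mpr hx
    nlinarith
  refine dBM_le_of (by linarith)
    (((ee F m).trans (S.prodCongr (LinearEquiv.refl ℝ _))).trans (ee E m).symm) (fun z => ?_)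
  simp only [LinearEquiv.trans_apply, nn_ee_symm]
  rw [← nn_ee]
  generalize ee F m z = w
  have h1 := hS w.1
  unfold nn
  have h3 : 0 ≤ ∑ k, |w.2 k| := by positivity
  simp only [LinearEquiv.prodCongr_apply, LinearEquiv.refl_apply]
  constructor
  · linarith
  · nlinarith

end bm

/-- if `max(d_BM(X₁,ℓ₁²), d_BM(X₂,ℓ₁²)) ≥ d_BM(X₁,X₂)` for
`2`-dimensional spaces `X₁, X₂`, then adding an `ℓ₁ᵐ`-summand preserves the distance. -/
theorem stmt_16 (X₁ X₂ : Type)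
    [NormedAddCommGroup X₁] [NormedSpace ℝ X₁] [NormedAddCommGroup X₂] [NormedSpace ℝ X₂]
    (h₁ : Module.finrank ℝ X₁ = 2) (h₂ : Module.finrank ℝ X₂ = 2)
    (h : dBM X₁ X₂ ≤ max (dBM X₁ (PiLp 1 fun _ : Fin 2 => ℝ))
      (dBM X₂ (PiLp 1 fun _ : Fin 2 => ℝ)))
    (m : ℕ) (hm : 1 ≤ m) :
    dBM (WithLp 1 (X₁ × PiLp 1 fun _ : Fin m => ℝ))
        (WithLp 1 (X₂ × PiLp 1 fun _ : Fin m => ℝ)) = dBM X₁ X₂ := by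
  have : Nontrivial X₁ := Module.nontrivial_of_finrank_pos (R := ℝ) (by omega)
  have hf1 : FiniteDimensional ℝ X₁ := Module.finite_of_finrank_pos (by omega)
  have hf2 : FiniteDimensional ℝ X₂ := Module.finite_of_finrank_pos (by omega)
  let T₀ : X₁ ≃L[ℝ] X₂ := ContinuousLinearEquiv.ofFinrankEq (h₁.trans h₂.symm)
  let T₁ : WithLp 1 (X₁ × PiLp 1 fun _ : Fin m => ℝ) ≃L[ℝ]
      WithLp 1 (X₂ × PiLp 1 fun _ : Fin m => ℝ) :=
    (((ee X₁ m).trans (T₀.toLinearEquiv.prodCongr (LinearEquiv.refl ℝ _))).trans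
      (ee X₂ m).symm).toContinuousLinearEquiv
  apply le_antisymm
  · conv_rhs => unfold dBM
    refine le_csInf ⟨_, T₀, rfl⟩ ?_
    rintro c ⟨T, rfl⟩
    exact upper m T
  · conv_rhs => unfold dBM
    refine le_csInf ⟨_, T₁, rfl⟩ ?_
    rintro c ⟨T, rfl⟩
    rcases le_max_iff.mp h with h | h
    · exact lower h₁ h₂ h m T
    · rw [dBM_comm'] at h ⊢
      refine (lower h₂ h₁ h m T.symm).trans (le_of_eq ?_)
      rw [mul_comm]; rfl
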